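/- If φ is a finite Blaschke product, then the space of analytic functions u for which uC_φ is bounded on the Bloch space equals the multiplier space of the Bloch space: M(B,φ) = M(B). -/

import Mathlib

open Complex Metric Set Filter MeasureTheory Finset

noncomputable section

/-- The open unit disc in ℂ. -/
def D1 : Set ℂ := Metric.ball 0 1

/-- Analytic (holomorphic) on the open unit disc. -/
def AnalyticOnD (f : ℂ → ℂ) : Prop := DifferentiableOn ℂ f D1

/-- Bloch seminorm. -/
def blochSemi (f : ℂ → ℂ) : ℝ := ⨆ z : D1, (1 - ‖(z : ℂ)‖ ^ 2) * ‖deriv f (z : ℂ)‖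

/-- Bloch norm. -/
def blochNorm (f : ℂ → ℂ) : ℝ := ‖f 0‖ + blochSemi f

/-- Membership in the Bloch space. -/
def InBloch (f : ℂ → ℂ) : Prop :=
  AnalyticOnD f ∧ ∃ C, ∀ z ∈ D1, (1 - ‖z‖ ^ 2) * ‖deriv f z‖ ≤ C

/-- Sup norm over the unit disc. -/
def supNormD (f : ℂ → ℂ) : ℝ := ⨆ z : D1, ‖f (z : ℂ)‖

/-- Weighted composition operator uC_φ. -/
def wco (u φ : ℂ → ℂ) (f : ℂ → ℂ) : ℂ → ℂ := fun z => u z * f (φ z)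

/-- Multiplication operator M_u. -/
def mult (u : ℂ → ℂ) (f : ℂ → ℂ) : ℂ → ℂ := fun z => u z * f z

/-- The weight u_{(n)} = ∏_{j=0}^{n-1} u ∘ φ_j. -/
def wprod (u φ : ℂ → ℂ) (n : ℕ) : ℂ → ℂ := fun z => ∏ j ∈ Finset.range n, u (φ^[j] z)

/-- Boundedness of an operator on the Bloch space. -/
def BddOnBloch (T : (ℂ → ℂ) → (ℂ → ℂ)) : Prop :=
  ∃ C, ∀ f, InBloch f → InBloch (T f) ∧ blochNorm (T f) ≤ C * blochNorm f

/-- Operator norm on the Bloch space. -/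
def opNormB (T : (ℂ → ℂ) → (ℂ → ℂ)) : ℝ :=
  sInf {C : ℝ | 0 ≤ C ∧ ∀ f, InBloch f → blochNorm (T f) ≤ C * blochNorm f}

/-- Invertibility of an operator on the Bloch space (bounded two-sided inverse). -/
def InvertibleOnBloch (T : (ℂ → ℂ) → (ℂ → ℂ)) : Prop :=
  BddOnBloch T ∧ ∃ S, BddOnBloch S ∧
    ∀ f, InBloch f → Set.EqOn (S (T f)) f D1 ∧ Set.EqOn (T (S f)) f D1

/-- Spectrum of an operator acting on the Bloch space. -/
def blochSpectrum (T : (ℂ → ℂ) → (ℂ → ℂ)) : Set ℂ :=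
  {lam | ¬ InvertibleOnBloch (fun f z => lam * f z - T f z)}

/-- Automorphism of the unit disc (Möbius form). -/
def IsDiscAuto (φ : ℂ → ℂ) : Prop :=
  ∃ lam a : ℂ, ‖lam‖ = 1 ∧ a ∈ D1 ∧ ∀ z, φ z = lam * (a - z) / (1 - (starRingEnd ℂ) a * z)

/-- Hyperbolic distance on the unit disc. -/
def hypDist (z w : ℂ) : ℝ :=
  (1 / 2) * Real.log ((1 + ‖(z - w) / (1 - (starRingEnd ℂ) z * w)‖) /
    (1 - ‖(z - w) / (1 - (starRingEnd ℂ) z * w)‖))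

/-- The disc algebra A(𝔻). -/
def InDiscAlgebra (u : ℂ → ℂ) : Prop :=
  ContinuousOn u (Metric.closedBall 0 1) ∧ AnalyticOnD u

/-- u is bounded away from zero on the unit disc. -/
def BoundedAwayFromZero (u : ℂ → ℂ) : Prop := ∃ δ > 0, ∀ z ∈ D1, δ ≤ ‖u z‖

/-- Parabolic automorphism with unique fixed point a on the unit circle (φ'(a)=1). -/
def IsParabolicAuto (φ : ℂ → ℂ) (a : ℂ) : Prop :=
  IsDiscAuto φ ∧ ‖a‖ = 1 ∧ φ a = a ∧ deriv φ a = 1 ∧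
    ∀ w, ‖w‖ ≤ 1 → φ w = w → w = a

/-- Hyperbolic automorphism with attractive fixed point a and repulsive fixed point b. -/
def IsHyperbolicAuto (φ : ℂ → ℂ) (a b : ℂ) : Prop :=
  IsDiscAuto φ ∧ ‖a‖ = 1 ∧ ‖b‖ = 1 ∧ a ≠ b ∧ φ a = a ∧ φ b = b ∧
    ∃ μ : ℝ, 0 < μ ∧ μ < 1 ∧ deriv φ a = (μ : ℂ)

/-- Square of the Dirichlet norm (normalized area measure on 𝔻). -/
def dirichletNormSq (f : ℂ → ℂ) : ℝ :=
  ‖f 0‖ ^ 2 + (1 / Real.pi) * ∫ z in D1, ‖deriv f z‖ ^ 2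

/-- Dirichlet norm. -/
def dirichletNorm (f : ℂ → ℂ) : ℝ := Real.sqrt (dirichletNormSq f)

/-- Membership in the Dirichlet space. -/
def InDirichlet (f : ℂ → ℂ) : Prop :=
  AnalyticOnD f ∧ MeasureTheory.IntegrableOn (fun z => ‖deriv f z‖ ^ 2) D1

/-- Boundedness of an operator on the Dirichlet space. -/
def BddOnDirichlet (T : (ℂ → ℂ) → (ℂ → ℂ)) : Prop :=
  ∃ C, ∀ f, InDirichlet f → InDirichlet (T f) ∧ dirichletNorm (T f) ≤ C * dirichletNorm f

/-- Operator norm on the Dirichlet space. -/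
def opNormDir (T : (ℂ → ℂ) → (ℂ → ℂ)) : ℝ :=
  sInf {C : ℝ | 0 ≤ C ∧ ∀ f, InDirichlet f → dirichletNorm (T f) ≤ C * dirichletNorm f}

/-- Invertibility of an operator on the Dirichlet space. -/
def InvertibleOnDirichlet (T : (ℂ → ℂ) → (ℂ → ℂ)) : Prop :=
  BddOnDirichlet T ∧ ∃ S, BddOnDirichlet S ∧
    ∀ f, InDirichlet f → Set.EqOn (S (T f)) f D1 ∧ Set.EqOn (T (S f)) f D1

/-- Spectrum of an operator on the Dirichlet space. -/
def dirichletSpectrum (T : (ℂ → ℂ) → (ℂ → ℂ)) : Set ℂ :=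
  {lam | ¬ InvertibleOnDirichlet (fun f z => lam * f z - T f z)}

/-- Operator norm of M_{u'} : B → H^∞_{v₁}. -/
def opNormBtoHv1 (u : ℂ → ℂ) : ℝ :=
  sInf {C : ℝ | 0 ≤ C ∧ ∀ f, InBloch f → ∀ z ∈ D1,
    (1 - ‖z‖ ^ 2) * ‖deriv u z * f z‖ ≤ C * blochNorm f}

/-- Operator norm of M_{u'} : 𝒟 → A². -/
def opNormDtoA2 (u : ℂ → ℂ) : ℝ :=
  sInf {C : ℝ | 0 ≤ C ∧ ∀ f, InDirichlet f →
    Real.sqrt ((1 / Real.pi) * ∫ z in D1, ‖deriv u z * f z‖ ^ 2) ≤ C * dirichletNorm f}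

/-- The logarithmic weight log(e/(1-|z|²)). -/
def logWeight (z : ℂ) : ℝ := Real.log (Real.exp 1 / (1 - ‖z‖ ^ 2))

/-- Characterization of multipliers of the Bloch space: u ∈ H^∞ and the log condition. -/
def MultBChar (u : ℂ → ℂ) : Prop :=
  (∃ M, ∀ z ∈ D1, ‖u z‖ ≤ M) ∧
  (∃ M, ∀ z ∈ D1, (1 - ‖z‖ ^ 2) * ‖deriv u z‖ * logWeight z ≤ M)


structure NiceMap (φ : ℂ → ℂ) : Prop where
  an : ∀ z, ‖z‖ ≤ 1 → AnalyticAt ℂ φ z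
  lower : ∃ c : ℝ, 0 < c ∧ ∀ z, ‖z‖ < 1 → c * (1 - ‖z‖ ^ 2) ≤ 1 - ‖φ z‖ ^ 2
  upper : ∃ c : ℝ, 0 < c ∧ ∀ z, ‖z‖ < 1 → 1 - ‖φ z‖ ^ 2 ≤ c * (1 - ‖z‖ ^ 2)
  dne : ∀ z, ‖z‖ = 1 → deriv φ z ≠ 0

lemma mem_D1 {z : ℂ} : z ∈ D1 ↔ ‖z‖ < 1 := by simp [D1]

lemma isOpen_D1 : IsOpen D1 := Metric.isOpen_ball

lemma one_sub_sq_pos {z : ℂ} (hz : ‖z‖ < 1) : 0 < 1 - ‖z‖ ^ 2 := by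
  nlinarith [norm_nonneg z]

lemma NiceMap.maps {φ : ℂ → ℂ} (h : NiceMap φ) {z : ℂ} (hz : ‖z‖ < 1) : ‖φ z‖ < 1 := by
  obtain ⟨c, hc, hh⟩ := h.lower
  have := hh z hz
  have h2 := mul_pos hc (one_sub_sq_pos hz)
  nlinarith [norm_nonneg (φ z)]

lemma niceMap_id : NiceMap (fun z => z) where
  an := fun z _ => analyticAt_id
  lower := ⟨1, one_pos, fun z _ => by simp⟩
  upper := ⟨1, one_pos, fun z _ => by simp⟩
  dne := fun z _ => by simp

lemma AnalyticOnD.da {f : ℂ → ℂ} (h : AnalyticOnD f) {z : ℂ} (hz : ‖z‖ < 1) :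
    DifferentiableAt ℂ f z := h.differentiableAt (isOpen_D1.mem_nhds (mem_D1.2 hz))

lemma semi_ge {f : ℂ → ℂ} (h : InBloch f) {z : ℂ} (hz : ‖z‖ < 1) :
    (1 - ‖z‖ ^ 2) * ‖deriv f z‖ ≤ blochSemi f := by
  obtain ⟨C, hC⟩ := h.2
  exact le_ciSup (f := fun z : D1 => (1 - ‖(z : ℂ)‖ ^ 2) * ‖deriv f (z : ℂ)‖)
    ⟨C, by rintro _ ⟨w, rfl⟩; exact hC w w.2⟩ ⟨z, mem_D1.2 hz⟩

lemma semi_le {f : ℂ → ℂ} {C : ℝ} (h : ∀ z, ‖z‖ < 1 → (1 - ‖z‖ ^ 2) * ‖deriv f z‖ ≤ C) :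
    blochSemi f ≤ C := by
  have : Nonempty D1 := ⟨⟨0, mem_D1.2 (by simp)⟩⟩
  exact ciSup_le fun w => h w (mem_D1.1 w.2)

lemma semi_nonneg {f : ℂ → ℂ} (h : InBloch f) : 0 ≤ blochSemi f := by
  have := semi_ge h (z := 0) (by simp)
  refine le_trans ?_ this
  simp

lemma bnorm_nonneg {f : ℂ → ℂ} (h : InBloch f) : 0 ≤ blochNorm f :=
  add_nonneg (norm_nonneg _) (semi_nonneg h)

lemma logWeight_eq {z : ℂ} (hz : ‖z‖ < 1) : logWeight z = 1 - Real.log (1 - ‖z‖ ^ 2) := by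
  rw [logWeight, Real.log_div (Real.exp_pos 1).ne' (one_sub_sq_pos hz).ne', Real.log_exp]

lemma one_le_logWeight {z : ℂ} (hz : ‖z‖ < 1) : 1 ≤ logWeight z := by
  rw [logWeight_eq hz]
  have := Real.log_nonpos (one_sub_sq_pos hz).le (by nlinarith [norm_nonneg z])
  linarith

lemma growth {f : ℂ → ℂ} (h : InBloch f) {w : ℂ} (hw : ‖w‖ < 1) :
    ‖f w‖ ≤ blochNorm f * logWeight w := by
  set r := ‖w‖ with hr
  have hr0 : 0 ≤ r := norm_nonneg w
  set S := blochSemi f with hS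
  have hS0 : 0 ≤ S := semi_nonneg h
  have hin : ∀ t ∈ Icc (0 : ℝ) 1, ‖(t : ℂ) * w‖ = t * r := by
    intro t ht
    rw [norm_mul, Complex.norm_real, Real.norm_of_nonneg ht.1]
  have hlt : ∀ t ∈ Icc (0 : ℝ) 1, t * r < 1 := by
    intro t ht
    nlinarith [ht.1, ht.2]
  have hg : ∀ t ∈ Icc (0 : ℝ) 1, HasDerivAt (fun t : ℝ => f ((t : ℂ) * w))
      (deriv f (t * w) * w) t := by
    intro t ht
    have h1 : HasDerivAt f (deriv f (t * w)) ((t : ℂ) * w) :=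
      (h.1.da (by rw [hin t ht]; exact hlt t ht)).hasDerivAt
    have h2 : HasDerivAt (fun t : ℝ => (t : ℂ) * w) w t := by
      simpa using (Complex.ofRealCLM.hasDerivAt (x := t)).mul_const w
    exact h1.comp t h2
  have hBd : ∀ t ∈ Icc (0 : ℝ) 1, HasDerivAt
      (fun t : ℝ => ‖f 0‖ + S * (- Real.log (1 - t * r))) (S * (r / (1 - t * r))) t := by
    intro t ht
    have h0 : 1 - t * r ≠ 0 := by linarith [hlt t ht]
    have h1 : HasDerivAt (fun t : ℝ => 1 - t * r) (-r) t := by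
      simpa using ((hasDerivAt_id t).mul_const r).const_sub 1
    have h2 := ((h1.log h0).neg.const_mul S).const_add ‖f 0‖
    refine h2.congr_deriv ?_
    ring
  have key := image_norm_le_of_norm_deriv_right_le_deriv_boundary'
    (f := fun t : ℝ => f ((t : ℂ) * w)) (f' := fun t : ℝ => deriv f (t * w) * w) (a := 0) (b := 1)
    (fun t ht => (hg t ht).continuousAt.continuousWithinAt)
    (fun t ht => (hg t ⟨ht.1, ht.2.le⟩).hasDerivWithinAt)
    (B := fun t : ℝ => ‖f 0‖ + S * (- Real.log (1 - t * r)))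
    (B' := fun t => S * (r / (1 - t * r)))
    (by simp)
    (fun t ht => (hBd t ht).continuousAt.continuousWithinAt)
    (fun t ht => (hBd t ⟨ht.1, ht.2.le⟩).hasDerivWithinAt)
    (by
      intro t ht
      have ht' : t ∈ Icc (0 : ℝ) 1 := ⟨ht.1, ht.2.le⟩
      have h3 := semi_ge h (z := t * w) (by rw [hin t ht']; exact hlt t ht')
      rw [hin t ht'] at h3
      have h4 := hlt t ht'
      have h5 : 0 ≤ t * r := mul_nonneg ht.1 hr0
      have h6 : ‖deriv f (t * w)‖ * (1 - t * r) ≤ S := by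
        refine le_trans ?_ h3
        rw [mul_comm]
        apply mul_le_mul_of_nonneg_right _ (norm_nonneg _)
        nlinarith
      rw [norm_mul, ← hr]
      have h7 : ‖deriv f (t * w)‖ ≤ S / (1 - t * r) := by
        rw [le_div_iff₀ (by linarith)]; exact h6
      calc ‖deriv f (t * w)‖ * r ≤ S / (1 - t * r) * r := by gcongr
        _ = S * (r / (1 - t * r)) := by ring)
    (x := 1) ⟨zero_le_one, le_rfl⟩
  simp only [Complex.ofReal_one, one_mul] at key
  have hL := one_le_logWeight hw
  have h8 : - Real.log (1 - r) ≤ logWeight w := by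
    rw [logWeight_eq hw, ← hr]
    have h9 : Real.log (1 - r ^ 2) = Real.log (1 - r) + Real.log (1 + r) := by
      rw [← Real.log_mul (by linarith) (by linarith)]; congr 1; ring
    have h10 : Real.log (1 + r) ≤ 1 := by
      have := Real.log_le_sub_one_of_pos (show 0 < 1 + r by linarith)
      linarith
    linarith
  calc ‖f w‖ ≤ _ := key
    _ ≤ ‖f 0‖ * logWeight w + S * logWeight w := by
        apply add_le_add
        · exact le_mul_of_one_le_right (norm_nonneg _) hL
        · gcongr
    _ = _ := by rw [blochNorm]; ring

lemma hasDeriv_wco {u φ f : ℂ → ℂ} (hu : AnalyticOnD u) (hφ : NiceMap φ) (hf : AnalyticOnD f)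
    {z : ℂ} (hz : ‖z‖ < 1) : HasDerivAt (wco u φ f)
      (deriv u z * f (φ z) + u z * (deriv f (φ z) * deriv φ z)) z := by
  have h1 := (hu.da hz).hasDerivAt
  have h2 := (hφ.an z hz.le).differentiableAt.hasDerivAt
  have h3 := (hf.da (hφ.maps hz)).hasDerivAt
  exact h1.mul (h3.comp z h2)

lemma deriv_bdd {φ : ℂ → ℂ} (hφ : NiceMap φ) :
    ∃ C, 0 ≤ C ∧ ∀ z, ‖z‖ < 1 → ‖deriv φ z‖ ≤ C := by
  obtain ⟨C, hC⟩ := (isCompact_closedBall (0 : ℂ) 1).exists_bound_of_continuousOn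
    (f := deriv φ) (fun z hz =>
      (hφ.an z (by simpa using hz)).deriv.continuousAt.continuousWithinAt)
  exact ⟨|C|, abs_nonneg _, fun z hz => (hC z (by simpa using hz.le)).trans (le_abs_self C)⟩

lemma log_le_of_le {z w : ℂ} (hz : ‖z‖ < 1) (hw : ‖w‖ < 1) {c : ℝ} (hc : 0 < c)
    (h : c * (1 - ‖z‖ ^ 2) ≤ 1 - ‖w‖ ^ 2) : logWeight w ≤ (1 + |Real.log c|) * logWeight z := by
  have h1 := one_le_logWeight hz
  have h2 := Real.log_le_log (mul_pos hc (one_sub_sq_pos hz)) h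
  rw [Real.log_mul hc.ne' (one_sub_sq_pos hz).ne'] at h2
  have h3 := neg_abs_le (Real.log c)
  have h4 := logWeight_eq hz
  have h5 := logWeight_eq hw
  nlinarith [abs_nonneg (Real.log c)]

lemma suff {u φ : ℂ → ℂ} (hu : AnalyticOnD u) (hφ : NiceMap φ) (h : MultBChar u) :
    BddOnBloch (wco u φ) := by
  obtain ⟨⟨M, hM⟩, ⟨K, hK⟩⟩ := h
  obtain ⟨c, hc, hcl⟩ := hφ.lower
  obtain ⟨A, hA0, hA⟩ := deriv_bdd hφ
  have hM0 : 0 ≤ M := (norm_nonneg _).trans (hM 0 (mem_D1.2 (by simp)))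
  set Q := (1 + |Real.log c|) with hQ
  have hQ0 : 0 ≤ Q := by positivity
  have main : ∀ f, InBloch f → ∀ z, ‖z‖ < 1 →
      (1 - ‖z‖ ^ 2) * ‖deriv (wco u φ f) z‖ ≤ (Q * K + M * A / c) * blochNorm f := by
    intro f hf z hz
    have hn := bnorm_nonneg hf
    rw [(hasDeriv_wco hu hφ hf.1 hz).deriv]
    have hp := one_sub_sq_pos hz
    have hw := hφ.maps hz
    have g1 : ‖f (φ z)‖ ≤ blochNorm f * (Q * logWeight z) :=
      (growth hf hw).trans (by gcongr; exact log_le_of_le hz hw hc (hcl z hz))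
    have g2 : c * (1 - ‖z‖ ^ 2) * ‖deriv f (φ z)‖ ≤ blochNorm f :=
      calc _ ≤ (1 - ‖φ z‖ ^ 2) * ‖deriv f (φ z)‖ := by gcongr; exact hcl z hz
        _ ≤ blochSemi f := semi_ge hf hw
        _ ≤ _ := by rw [blochNorm]; linarith [norm_nonneg (f 0)]
    have g2' : (1 - ‖z‖ ^ 2) * ‖deriv f (φ z)‖ ≤ blochNorm f / c := by
      rw [le_div_iff₀ hc]; linarith
    calc (1 - ‖z‖ ^ 2) * ‖deriv u z * f (φ z) + u z * (deriv f (φ z) * deriv φ z)‖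
        ≤ (1 - ‖z‖ ^ 2) * (‖deriv u z‖ * ‖f (φ z)‖ + ‖u z‖ * (‖deriv f (φ z)‖ * ‖deriv φ z‖)) := by
          gcongr
          refine (norm_add_le _ _).trans ?_
          simp
      _ = (1 - ‖z‖ ^ 2) * ‖deriv u z‖ * ‖f (φ z)‖
          + ‖u z‖ * (((1 - ‖z‖ ^ 2) * ‖deriv f (φ z)‖) * ‖deriv φ z‖) := by ring
      _ ≤ (1 - ‖z‖ ^ 2) * ‖deriv u z‖ * (blochNorm f * (Q * logWeight z))
          + M * ((blochNorm f / c) * A) := by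
          gcongr
          · exact hM z (mem_D1.2 hz)
          · exact hA z hz
      _ = Q * blochNorm f * ((1 - ‖z‖ ^ 2) * ‖deriv u z‖ * logWeight z)
          + M * ((blochNorm f / c) * A) := by ring
      _ ≤ Q * blochNorm f * K + M * ((blochNorm f / c) * A) := by
          gcongr
          exact hK z (mem_D1.2 hz)
      _ = _ := by ring
  refine ⟨M * logWeight (φ 0) + (Q * K + M * A / c), fun f hf => ⟨⟨?_, _, fun z hz => main f hf z (mem_D1.1 hz)⟩, ?_⟩⟩
  · intro z hz
    exact (hasDeriv_wco hu hφ hf.1 (mem_D1.1 hz)).differentiableAt.differentiableWithinAt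
  · rw [blochNorm, add_mul]
    apply add_le_add _ (semi_le (main f hf))
    have h0 : ‖φ 0‖ < 1 := hφ.maps (by simp)
    calc ‖u 0 * f (φ 0)‖ = ‖u 0‖ * ‖f (φ 0)‖ := norm_mul _ _
      _ ≤ M * (blochNorm f * logWeight (φ 0)) := by
        gcongr
        · exact hM 0 (mem_D1.2 (by simp))
        · exact growth hf h0
      _ = _ := by ring

lemma test_bound {u φ : ℂ → ℂ} (hu : AnalyticOnD u) (hφ : NiceMap φ) (h : BddOnBloch (wco u φ)) :
    ∃ C, 0 ≤ C ∧ ∀ f f' : ℂ → ℂ, (∀ z, ‖z‖ < 1 → HasDerivAt f (f' z) z) → ‖f 0‖ ≤ 1 →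
      (∀ z, ‖z‖ < 1 → (1 - ‖z‖ ^ 2) * ‖f' z‖ ≤ 2) → ∀ z, ‖z‖ < 1 →
      (1 - ‖z‖ ^ 2) * ‖deriv u z * f (φ z) + u z * (f' (φ z) * deriv φ z)‖ ≤ C := by
  obtain ⟨C, hC⟩ := h
  refine ⟨|C| * 3, by positivity, fun f f' hd h0 hs z hz => ?_⟩
  have hs' : ∀ z, ‖z‖ < 1 → (1 - ‖z‖ ^ 2) * ‖deriv f z‖ ≤ 2 := by
    intro z hz
    rw [(hd z hz).deriv]; exact hs z hz
  have hf : InBloch f := ⟨fun z hz => (hd z (mem_D1.1 hz)).differentiableAt.differentiableWithinAt,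
    2, fun z hz => hs' z (mem_D1.1 hz)⟩
  have hn : blochNorm f ≤ 3 := by
    rw [blochNorm]; linarith [semi_le hs']
  obtain ⟨h1, h2⟩ := hC f hf
  have h3 := semi_ge h1 hz
  rw [(hasDeriv_wco hu hφ hf.1 hz).deriv, (hd _ (hφ.maps hz)).deriv] at h3
  calc _ ≤ _ := h3
    _ ≤ blochNorm (wco u φ f) := by rw [blochNorm]; linarith [norm_nonneg (wco u φ f 0)]
    _ ≤ C * blochNorm f := h2
    _ ≤ |C| * 3 := by
      have := bnorm_nonneg hf
      gcongr
      exact le_abs_self C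

lemma norm_den {w z : ℂ} : 1 - ‖w‖ * ‖z‖ ≤ ‖1 - (starRingEnd ℂ) w * z‖ := by
  have := norm_sub_norm_le (1 : ℂ) ((starRingEnd ℂ) w * z)
  simpa using this

lemma den_ne {w z : ℂ} (hw : ‖w‖ < 1) (hz : ‖z‖ ≤ 1) : 1 - (starRingEnd ℂ) w * z ≠ 0 := by
  have := norm_den (w := w) (z := z)
  rw [← norm_pos_iff]
  nlinarith [norm_nonneg w, norm_nonneg z]

lemma hasDerivAt_den (w z : ℂ) :
    HasDerivAt (fun z => 1 - (starRingEnd ℂ) w * z) (-(starRingEnd ℂ) w) z := by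
  simpa using ((hasDerivAt_id z).const_mul ((starRingEnd ℂ) w)).const_sub 1

lemma hasDerivAt_mob {w z : ℂ} (hw : ‖w‖ < 1) (hz : ‖z‖ ≤ 1) :
    HasDerivAt (fun z => (z - w) / (1 - (starRingEnd ℂ) w * z))
      (((1 - ‖w‖ ^ 2 : ℝ) : ℂ) / (1 - (starRingEnd ℂ) w * z) ^ 2) z := by
  have h := ((hasDerivAt_id z).sub_const w).div (hasDerivAt_den w z) (den_ne hw hz)
  refine h.congr_deriv ?_
  congr 1
  have : ((‖w‖ ^ 2 : ℝ) : ℂ) = w * (starRingEnd ℂ) w := by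
    rw [Complex.mul_conj, Complex.normSq_eq_norm_sq]
  rw [Complex.ofReal_sub, this]
  simp
  ring

lemma nec {u φ : ℂ → ℂ} (hu : AnalyticOnD u) (hφ : NiceMap φ) (h : BddOnBloch (wco u φ)) :
    MultBChar u := by
  obtain ⟨C, hC0, hC⟩ := test_bound hu hφ h
  obtain ⟨c, hc, hup⟩ := hφ.upper
  -- the constant test function
  have t1 : ∀ z, ‖z‖ < 1 → (1 - ‖z‖ ^ 2) * ‖deriv u z‖ ≤ C := by
    intro z hz
    simpa using hC (fun _ => 1) (fun _ => 0) (fun z _ => hasDerivAt_const z 1) (by simp)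
      (by simp) z hz
  -- Moebius test functions
  have t2 : ∀ z, ‖z‖ < 1 → (1 - ‖z‖ ^ 2) * ‖u z‖ * ‖deriv φ z‖ ≤ C * (1 - ‖φ z‖ ^ 2) := by
    intro z hz
    have hw := hφ.maps hz
    set w := φ z with hwd
    have hp := one_sub_sq_pos hw
    have key := hC (fun z => (z - w) / (1 - (starRingEnd ℂ) w * z))
      (fun z => ((1 - ‖w‖ ^ 2 : ℝ) : ℂ) / (1 - (starRingEnd ℂ) w * z) ^ 2)
      (fun z hz => hasDerivAt_mob hw hz.le) (by simpa using hw.le) (by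
        intro v hv
        have h1 := norm_den (w := w) (z := v)
        have h2 := norm_nonneg w
        have h3 := norm_nonneg v
        have h4 : 0 < 1 - ‖w‖ * ‖v‖ := by nlinarith
        rw [norm_div, norm_pow, Complex.norm_real, Real.norm_of_nonneg hp.le, ← mul_div_assoc,
          div_le_iff₀ (by have := h4.trans_le h1; positivity)]
        have h5 : (1 - ‖w‖ * ‖v‖) ^ 2 ≤ ‖1 - (starRingEnd ℂ) w * v‖ ^ 2 := by gcongr
        nlinarith [sq_nonneg (‖w‖ - ‖v‖), sq_nonneg (‖1 - (starRingEnd ℂ) w * v‖)]) z hz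
    have e : 1 - (starRingEnd ℂ) w * w = ((1 - ‖w‖ ^ 2 : ℝ) : ℂ) := by
      rw [mul_comm, Complex.mul_conj, Complex.normSq_eq_norm_sq]; simp
    simp only [← hwd, sub_self, zero_div, mul_zero, zero_add, e, norm_mul, norm_div, norm_pow,
      Complex.norm_real, Real.norm_of_nonneg hp.le] at key
    calc _ = ((1 - ‖z‖ ^ 2) * (‖u z‖ * ((1 - ‖w‖ ^ 2) / (1 - ‖w‖ ^ 2) ^ 2 * ‖deriv φ z‖)))
          * (1 - ‖w‖ ^ 2) := by field_simp
      _ ≤ _ := by gcongr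
  -- logarithmic test functions
  have t3 : ∀ z, ‖z‖ < 1 → (1 - ‖z‖ ^ 2) * ‖deriv u z‖ * logWeight (φ z) ≤ 3 * C := by
    intro z hz
    have hw := hφ.maps hz
    have b2 := t2 z hz
    have b1 := t1 z hz
    set w := φ z with hwd
    have hp := one_sub_sq_pos hw
    have hpz := one_sub_sq_pos hz
    have key := hC (fun z => Complex.log (1 - (starRingEnd ℂ) w * z))
      (fun z => -(starRingEnd ℂ) w / (1 - (starRingEnd ℂ) w * z))
      (fun v hv => by
        refine (hasDerivAt_den w v).clog ?_
        left
        have : ((starRingEnd ℂ) w * v).re ≤ ‖w‖ * ‖v‖ := by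
          simpa using Complex.re_le_norm ((starRingEnd ℂ) w * v)
        have h2 := norm_nonneg w
        have h3 := norm_nonneg v
        rw [Complex.sub_re, Complex.one_re]
        nlinarith) (by simp) (by
        intro v hv
        have h1 := norm_den (w := w) (z := v)
        have h2 := norm_nonneg w
        have h3 := norm_nonneg v
        have h4 : 1 - ‖v‖ ≤ 1 - ‖w‖ * ‖v‖ := by nlinarith
        rw [norm_div, norm_neg, Complex.norm_conj, ← mul_div_assoc,
          div_le_iff₀ (by linarith)]
        have h5 := one_sub_sq_pos hv
        nlinarith) z hz
    have e : 1 - (starRingEnd ℂ) w * w = ((1 - ‖w‖ ^ 2 : ℝ) : ℂ) := by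
      rw [mul_comm, Complex.mul_conj, Complex.normSq_eq_norm_sq]; simp
    have hl : Real.log (1 - ‖w‖ ^ 2) ≤ 0 :=
      Real.log_nonpos hp.le (by nlinarith [norm_nonneg w])
    simp only [← hwd, e] at key
    rw [← Complex.ofReal_log hp.le] at key
    set A := deriv u z * ((Real.log (1 - ‖w‖ ^ 2) : ℝ) : ℂ) with hA
    set B := u z * (-(starRingEnd ℂ) w / ((1 - ‖w‖ ^ 2 : ℝ) : ℂ) * deriv φ z) with hBB
    have nA : ‖A‖ = ‖deriv u z‖ * (- Real.log (1 - ‖w‖ ^ 2)) := by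
      rw [hA, norm_mul, Complex.norm_real, Real.norm_of_nonpos hl]
    have nB : (1 - ‖z‖ ^ 2) * ‖B‖ ≤ C := by
      rw [hBB, norm_mul, norm_mul, norm_div, norm_neg, Complex.norm_conj, Complex.norm_real,
        Real.norm_of_nonneg hp.le]
      calc (1 - ‖z‖ ^ 2) * (‖u z‖ * (‖w‖ / (1 - ‖w‖ ^ 2) * ‖deriv φ z‖))
          = ‖w‖ * (((1 - ‖z‖ ^ 2) * ‖u z‖ * ‖deriv φ z‖) / (1 - ‖w‖ ^ 2)) := by ring
        _ ≤ 1 * C := by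
          gcongr
          rw [div_le_iff₀ hp]; exact b2
        _ = C := one_mul C
    have hAB : ‖A‖ ≤ ‖A + B‖ + ‖B‖ := by
      simpa using norm_sub_le (A + B) B
    rw [logWeight_eq hw]
    calc _ = (1 - ‖z‖ ^ 2) * ‖deriv u z‖ + (1 - ‖z‖ ^ 2) * ‖A‖ := by rw [nA]; ring
      _ ≤ (1 - ‖z‖ ^ 2) * ‖deriv u z‖ + (1 - ‖z‖ ^ 2) * (‖A + B‖ + ‖B‖) := by gcongr
      _ ≤ _ := by linarith
  constructor
  · -- lower bound for the derivative near the circle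
    have hcont : ContinuousOn (fun z => max ‖deriv φ z‖ (1 - ‖z‖)) (closedBall (0 : ℂ) 1) := by
      intro z hz
      have h1 := (hφ.an z (by simpa using hz)).deriv.continuousAt
      have h2 : ContinuousAt (fun z : ℂ => 1 - ‖z‖) z := by fun_prop
      exact ContinuousAt.continuousWithinAt (Filter.Tendsto.max h1.norm h2)
    obtain ⟨x, hx, hmin⟩ := (isCompact_closedBall (0 : ℂ) 1).exists_isMinOn
      ⟨0, by simp⟩ hcont
    set m := max ‖deriv φ x‖ (1 - ‖x‖) with hm
    have hm0 : 0 < m := by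
      rcases lt_or_eq_of_le (show ‖x‖ ≤ 1 by simpa using hx) with h1 | h1
      · exact lt_max_of_lt_right (by linarith)
      · exact lt_max_of_lt_left (norm_pos_iff.2 (hφ.dne x h1))
    have hcu : ContinuousOn u (closedBall 0 (1 - m)) := by
      refine hu.continuousOn.mono fun z hz => mem_D1.2 ?_
      have : ‖z‖ ≤ 1 - m := by simpa using hz
      linarith
    obtain ⟨M, hM⟩ := (isCompact_closedBall (0 : ℂ) (1 - m)).exists_bound_of_continuousOn hcu
    refine ⟨max M (C * c / m), fun z hz => ?_⟩
    have hz' := mem_D1.1 hz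
    have h1 : m ≤ max ‖deriv φ z‖ (1 - ‖z‖) := hmin (show z ∈ closedBall (0 : ℂ) 1 by simpa using hz'.le)
    rcases le_max_iff.1 h1 with h2 | h2
    · apply le_max_of_le_right
      rw [le_div_iff₀ hm0]
      have hp := one_sub_sq_pos hz'
      have h3 := t2 z hz'
      have h4 := hup z hz'
      have h5 : (1 - ‖z‖ ^ 2) * (‖u z‖ * m) ≤ (1 - ‖z‖ ^ 2) * (C * c) := by
        calc _ = (1 - ‖z‖ ^ 2) * ‖u z‖ * m := by ring
          _ ≤ (1 - ‖z‖ ^ 2) * ‖u z‖ * ‖deriv φ z‖ := by gcongr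
          _ ≤ _ := h3
          _ ≤ C * (c * (1 - ‖z‖ ^ 2)) := by gcongr
          _ = _ := by ring
      exact le_of_mul_le_mul_left h5 hp
    · apply le_max_of_le_left
      exact hM z (by simp; linarith)
  · refine ⟨(1 + |Real.log c⁻¹|) * (3 * C), fun z hz => ?_⟩
    have hz' := mem_D1.1 hz
    have hp := one_sub_sq_pos hz'
    have h1 := log_le_of_le (hφ.maps hz') hz' (inv_pos.2 hc) (by
      rw [inv_mul_le_iff₀ hc]; exact hup z hz')
    calc _ ≤ (1 - ‖z‖ ^ 2) * ‖deriv u z‖ * ((1 + |Real.log c⁻¹|) * logWeight (φ z)) := by gcongr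
      _ = (1 + |Real.log c⁻¹|) * ((1 - ‖z‖ ^ 2) * ‖deriv u z‖ * logWeight (φ z)) := by ring
      _ ≤ _ := mul_le_mul_of_nonneg_left (t3 z hz') (by positivity)

lemma blaschke_id (a z : ℂ) : ‖1 - (starRingEnd ℂ) a * z‖ ^ 2 - ‖z - a‖ ^ 2
    = (1 - ‖a‖ ^ 2) * (1 - ‖z‖ ^ 2) := by
  simp only [Complex.sq_norm, Complex.normSq_apply, Complex.sub_re, Complex.sub_im,
    Complex.mul_re, Complex.mul_im, Complex.conj_re, Complex.conj_im, Complex.one_re,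
    Complex.one_im]
  ring

lemma factor_id {a z : ℂ} (ha : ‖a‖ < 1) (hz : ‖z‖ ≤ 1) :
    1 - ‖(z - a) / (1 - (starRingEnd ℂ) a * z)‖ ^ 2
      = (1 - ‖a‖ ^ 2) * (1 - ‖z‖ ^ 2) / ‖1 - (starRingEnd ℂ) a * z‖ ^ 2 := by
  have h := norm_pos_iff.2 (den_ne ha hz)
  rw [norm_div, div_pow, ← blaschke_id, sub_div, div_self (by positivity)]

lemma factor_le_one {a z : ℂ} (ha : ‖a‖ < 1) (hz : ‖z‖ ≤ 1) :
    ‖(z - a) / (1 - (starRingEnd ℂ) a * z)‖ ^ 2 ≤ 1 := by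
  have h := factor_id ha hz
  have h1 := one_sub_sq_pos ha
  have h2 : 0 ≤ 1 - ‖z‖ ^ 2 := by nlinarith [norm_nonneg z]
  have : 0 ≤ (1 - ‖a‖ ^ 2) * (1 - ‖z‖ ^ 2) / ‖1 - (starRingEnd ℂ) a * z‖ ^ 2 := by positivity
  linarith

lemma one_sub_prod_le {ι : Type*} (s : Finset ι) (x : ι → ℝ) (h0 : ∀ i, 0 ≤ x i)
    (h1 : ∀ i, x i ≤ 1) : 1 - ∏ i ∈ s, x i ≤ ∑ i ∈ s, (1 - x i) := by
  classical
  induction s using Finset.induction_on with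
  | empty => simp
  | insert i s hi ih =>
    rw [Finset.prod_insert hi, Finset.sum_insert hi]
    have hp : ∏ i ∈ s, x i ≤ 1 := Finset.prod_le_one (fun i _ => h0 i) (fun i _ => h1 i)
    nlinarith [h1 i]

lemma logDeriv_factor {a z : ℂ} (ha : ‖a‖ < 1) (hz : ‖z‖ = 1) :
    z * logDeriv (fun z => (z - a) / (1 - (starRingEnd ℂ) a * z)) z
      = (((1 - ‖a‖ ^ 2) / ‖z - a‖ ^ 2 : ℝ) : ℂ) := by
  have hne : z - a ≠ 0 := by
    intro h
    rw [sub_eq_zero] at h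
    rw [h] at hz
    linarith
  have hzz : z * (starRingEnd ℂ) z = 1 := by
    rw [Complex.mul_conj, Complex.normSq_eq_norm_sq, hz]; simp
  have hz0 : z ≠ 0 := by
    intro h; rw [h] at hz; simp at hz
  have hd : 1 - (starRingEnd ℂ) a * z = z * (starRingEnd ℂ) (z - a) := by
    rw [map_sub, mul_sub, hzz]; ring
  have hc : (starRingEnd ℂ) (z - a) ≠ 0 := (map_ne_zero _).2 hne
  have hn : ((‖z - a‖ ^ 2 : ℝ) : ℂ) = (z - a) * (starRingEnd ℂ) (z - a) := by
    rw [Complex.mul_conj, Complex.normSq_eq_norm_sq]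
  rw [logDeriv_apply, (hasDerivAt_mob ha hz.le).deriv, hd, Complex.ofReal_div, hn]
  field_simp

lemma niceMap_blaschke {N : ℕ} (hN : 0 < N) {lam : ℂ} {a : Fin N → ℂ} (hl : ‖lam‖ = 1)
    (ha : ∀ j, ‖a j‖ < 1) :
    NiceMap (fun z => lam * ∏ j, (z - a j) / (1 - (starRingEnd ℂ) (a j) * z)) where
  an := by
    intro z hz
    refine analyticAt_const.mul (Finset.analyticAt_fun_prod _ fun j _ => ?_)
    exact (analyticAt_id.sub analyticAt_const).div
      (analyticAt_const.sub (analyticAt_const.mul analyticAt_id)) (den_ne (ha j) hz)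
  lower := by
    set j0 : Fin N := ⟨0, hN⟩
    have h1 := one_sub_sq_pos (ha j0)
    refine ⟨(1 - ‖a j0‖ ^ 2) / 4, by positivity, fun z hz => ?_⟩
    have hp := one_sub_sq_pos hz
    have h2 : ‖lam * ∏ j, (z - a j) / (1 - (starRingEnd ℂ) (a j) * z)‖ ^ 2
        ≤ ‖(z - a j0) / (1 - (starRingEnd ℂ) (a j0) * z)‖ ^ 2 := by
      rw [norm_mul, hl, one_mul, norm_prod, ← Finset.prod_pow,
        ← Finset.mul_prod_erase _ _ (Finset.mem_univ j0)]
      apply mul_le_of_le_one_right (by positivity)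
      exact Finset.prod_le_one (fun i _ => by positivity) (fun i _ => factor_le_one (ha i) hz.le)
    have h3 := factor_id (ha j0) hz.le
    have h4 : ‖1 - (starRingEnd ℂ) (a j0) * z‖ ^ 2 ≤ 4 := by
      have : ‖1 - (starRingEnd ℂ) (a j0) * z‖ ≤ 1 + ‖a j0‖ * ‖z‖ := by
        simpa using norm_sub_le (1 : ℂ) ((starRingEnd ℂ) (a j0) * z)
      have h5 : ‖a j0‖ * ‖z‖ ≤ 1 := mul_le_one₀ (ha j0).le (norm_nonneg _) hz.le
      nlinarith [norm_nonneg (1 - (starRingEnd ℂ) (a j0) * z)]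
    have h6 := norm_pos_iff.2 (den_ne (ha j0) hz.le)
    have h7 : (1 - ‖a j0‖ ^ 2) * (1 - ‖z‖ ^ 2) / 4
        ≤ (1 - ‖a j0‖ ^ 2) * (1 - ‖z‖ ^ 2) / ‖1 - (starRingEnd ℂ) (a j0) * z‖ ^ 2 := by
      gcongr
    linarith
  upper := by
    refine ⟨∑ j, (1 - ‖a j‖ ^ 2) / (1 - ‖a j‖) ^ 2, ?_, fun z hz => ?_⟩
    · have : Nonempty (Fin N) := ⟨⟨0, hN⟩⟩
      refine Finset.sum_pos (fun j _ => ?_) Finset.univ_nonempty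
      have h1 := one_sub_sq_pos (ha j)
      have h2 : 0 < 1 - ‖a j‖ := by linarith [ha j]
      positivity
    · rw [norm_mul, hl, one_mul, norm_prod, ← Finset.prod_pow, Finset.sum_mul]
      refine (one_sub_prod_le _ _ (fun i => by positivity)
        (fun i => factor_le_one (ha i) hz.le)).trans (Finset.sum_le_sum fun j _ => ?_)
      rw [factor_id (ha j) hz.le, div_mul_eq_mul_div]
      have hp := one_sub_sq_pos hz
      have h1 := one_sub_sq_pos (ha j)
      have h2 : 0 < 1 - ‖a j‖ := by linarith [ha j]
      have h3 : 1 - ‖a j‖ ≤ ‖1 - (starRingEnd ℂ) (a j) * z‖ := by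
        refine le_trans ?_ norm_den
        nlinarith [norm_nonneg (a j)]
      gcongr
  dne := by
    intro z hz hder
    have hl0 : lam ≠ 0 := by intro h; rw [h] at hl; simp at hl
    have hne : ∀ j, z - a j ≠ 0 := by
      intro j h
      rw [sub_eq_zero] at h
      have := ha j
      rw [← h] at this
      linarith
    have e : logDeriv (fun z => lam * ∏ j, (z - a j) / (1 - (starRingEnd ℂ) (a j) * z)) z
        = ∑ j, logDeriv (fun z => (z - a j) / (1 - (starRingEnd ℂ) (a j) * z)) z := by
      rw [logDeriv_const_mul _ _ hl0]
      exact logDeriv_prod (fun j _ => div_ne_zero (hne j) (den_ne (ha j) hz.le))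
        (fun j _ => (hasDerivAt_mob (ha j) hz.le).differentiableAt)
    rw [logDeriv_apply, hder, zero_div] at e
    have e2 : (0 : ℂ) = ((∑ j, (1 - ‖a j‖ ^ 2) / ‖z - a j‖ ^ 2 : ℝ) : ℂ) := by
      rw [Complex.ofReal_sum, ← mul_zero z, e, Finset.mul_sum]
      exact Finset.sum_congr rfl fun j _ => logDeriv_factor (ha j) hz
    have : Nonempty (Fin N) := ⟨⟨0, hN⟩⟩
    have e3 : 0 < ∑ j, (1 - ‖a j‖ ^ 2) / ‖z - a j‖ ^ 2 := by
      refine Finset.sum_pos (fun j _ => ?_) Finset.univ_nonempty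
      have h1 := one_sub_sq_pos (ha j)
      have h2 := norm_pos_iff.2 (hne j)
      positivity
    exact e3.ne (by exact_mod_cast e2)

/-- for a finite Blaschke product φ, M(B,φ) = M(B). -/
theorem stmt_4 (φ : ℂ → ℂ)
    (hB : ∃ (N : ℕ), 0 < N ∧ ∃ (lam : ℂ) (a : Fin N → ℂ), ‖lam‖ = 1 ∧
      (∀ j, a j ∈ D1) ∧
      ∀ z, φ z = lam * ∏ j, (z - a j) / (1 - (starRingEnd ℂ) (a j) * z)) :
    ∀ u, AnalyticOnD u → (BddOnBloch (wco u φ) ↔ BddOnBloch (mult u)) := by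
  obtain ⟨N, hN, lam, a, hl, ha, hφ⟩ := hB
  obtain rfl : φ = _ := funext hφ
  have h1 := niceMap_blaschke hN hl (fun j => mem_D1.1 (ha j))
  intro u hu
  have e : mult u = wco u (fun z => z) := rfl
  rw [e]
  exact ⟨fun h => suff hu niceMap_id (nec hu h1 h), fun h => suff hu h1 (nec hu niceMap_id h)⟩
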